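/- arXiv:2403.12148 — 2 statements merged into one kernel-verified Lean document; each statement's English description precedes it below -/
import Mathlib

section
/- Let c1, c2, c3, c4 be generic real numbers, N ≥ 0 an integer, and c0 = −2N−3−c1−c2−c3−c4. For all integers i, j, x, y ≥ 0 with i+j ≤ N and x+y ≤ N, the Tratnik polynomials of Racah type satisfy the duality relation T_{i,j}(x,y; c1,c2,c3,c4; N) / [ Ω(i; c1,c2,c3; N−j) · Λ(j; c4,c0; N) ] = T_{y,x}(j,i; c4,c0,c3,c1; N) / [ Ω(y; c4,c0,c3; N−x) · Λ(x; c1,c2; N) ]. -/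
open Finset

noncomputable section

/-- Pochhammer symbol `(a)_k = a (a+1) ⋯ (a+k-1)`. -/
def poch (a : ℝ) (k : ℕ) : ℝ := ∏ i ∈ Finset.range k, (a + i)

/-- A real number is *generic* if it is not an integer. -/
def Generic (r : ℝ) : Prop := ∀ m : ℤ, r ≠ (m : ℝ)

/-- Genericity for three parameters: none of the parameters, nor any sum of two or three
of them, is an integer; this guarantees that no denominator vanishes. -/
def Generic3 (c1 c2 c3 : ℝ) : Prop :=
  Generic c1 ∧ Generic c2 ∧ Generic c3 ∧
  Generic (c1+c2) ∧ Generic (c1+c3) ∧ Generic (c2+c3) ∧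
  Generic (c1+c2+c3)

/-- Genericity for four parameters: none of the parameters, nor any sum of two, three or
four of them, is an integer; this guarantees that no denominator vanishes. -/
def Generic4 (c1 c2 c3 c4 : ℝ) : Prop :=
  Generic c1 ∧ Generic c2 ∧ Generic c3 ∧ Generic c4 ∧
  Generic (c1+c2) ∧ Generic (c1+c3) ∧ Generic (c1+c4) ∧
  Generic (c2+c3) ∧ Generic (c2+c4) ∧ Generic (c3+c4) ∧
  Generic (c1+c2+c3) ∧ Generic (c1+c2+c4) ∧ Generic (c1+c3+c4) ∧ Generic (c2+c3+c4) ∧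
  Generic (c1+c2+c3+c4)

/-- Normalization `Ω(n; c1,c2,c3; M)`. -/
def Om (n : ℤ) (c1 c2 c3 : ℝ) (M : ℤ) : ℝ :=
  (M.toNat.choose n.toNat : ℝ) * (2*(n:ℝ) + c2 + c3 + 1) *
    poch (c2+1) n.toNat * poch ((M:ℝ)+2+c1+c2+c3) n.toNat * poch (c1+1) (M-n).toNat /
    (poch (c3+1) n.toNat * poch (c2+c3+(n:ℝ)+1) (M.toNat+1))

/-- The renormalized Racah polynomial `p_n(x; c1,c2,c3; M)`, with the convention that it
vanishes unless `0 ≤ n ≤ M`. -/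
def racah (n : ℤ) (x : ℝ) (c1 c2 c3 : ℝ) (M : ℤ) : ℝ :=
  if 0 ≤ n ∧ n ≤ M then
    Om n c1 c2 c3 M *
      ∑ k ∈ Finset.range (n.toNat + 1),
        (poch (-(n:ℝ)) k * poch ((n:ℝ)+c2+c3+1) k * poch (-x) k * poch (x+c1+c2+1) k) /
        (poch (c2+1) k * poch ((M:ℝ)+2+c1+c2+c3) k * poch (-(M:ℝ)) k * (Nat.factorial k : ℝ))
  else 0

/-- Weight `Λ(x; c1,c2; M)`. -/
def Lam (x : ℤ) (c1 c2 : ℝ) (M : ℤ) : ℝ :=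
  (-1:ℝ)^x.toNat * (M.toNat.choose x.toNat : ℝ) * (2*(x:ℝ)+c1+c2+1) * poch (c2+1) x.toNat /
    (poch (c1+1) x.toNat * poch ((x:ℝ)+c1+c2+1) (M.toNat+1))

/-- `λ(x; c) = x(x+c+1)`. -/
def lam (x c : ℝ) : ℝ := x*(x+c+1)

/-- `μ_n(c) = n(n+c+1)`. -/
def mu (n c : ℝ) : ℝ := n*(n+c+1)

/-- Recurrence coefficient `A_n(c1,c2,c3; M)`. -/
def coefA (n c1 c2 c3 M : ℝ) : ℝ :=
  (n-M)*(n+c1+c2+c3+M+2)*(n+c2+1)*(n+c2+c3+1)/((2*n+c2+c3+1)*(2*n+c2+c3+2))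

/-- Recurrence coefficient `C_n(c1,c2,c3; M)`. -/
def coefC (n c1 c2 c3 M : ℝ) : ℝ :=
  n*(n-c1-M-1)*(n+c2+c3+M+1)*(n+c3)/((2*n+c2+c3)*(2*n+c2+c3+1))

/-- `Σ_n = A_n + C_n`. -/
def coefSig (n c1 c2 c3 M : ℝ) : ℝ := coefA n c1 c2 c3 M + coefC n c1 c2 c3 M

/-- Difference coefficient `B(x; c1,c2,c3; M)`. -/
def coefB (x c1 c2 c3 M : ℝ) : ℝ :=
  (x-M)*(x+c2+1)*(x+c1+c2+c3+M+2)*(x+c1+c2+1)/((2*x+c1+c2+1)*(2*x+c1+c2+2))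

/-- Difference coefficient `D(x; c1,c2,c3; M)`. -/
def coefD (x c1 c2 c3 M : ℝ) : ℝ :=
  x*(x+c1)*(x-c3-M-1)*(x+c1+c2+M+1)/((2*x+c1+c2)*(2*x+c1+c2+1))

/-- `S = B + D`. -/
def coefS (x c1 c2 c3 M : ℝ) : ℝ := coefB x c1 c2 c3 M + coefD x c1 c2 c3 M

/-- `F(x; c1,c2)`. -/
def Ffun (x c1 c2 : ℝ) : ℝ :=
  (x+c2+1)*(x+c1+c2+1)/((2*x+c1+c2+1)*(2*x+c1+c2+2))

/-- `λ⁺(x; c12; M) = (x+c12+M+2)(x−M−1)`. -/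
def lamP (x c12 M : ℝ) : ℝ := (x+c12+M+2)*(x-M-1)

/-- `A⁺_n(c2,c3; M)`. -/
def Ap (n c2 c3 M : ℝ) : ℝ := -(n-M-1)*(n-M)*Ffun n c3 c2

/-- `C⁺_n(c2,c3; M) = A⁺_{−n−c23−1}(c2,c3; M)`. -/
def Cp (n c2 c3 M : ℝ) : ℝ := Ap (-n-c2-c3-1) c2 c3 M

/-- `Σ⁺_n = A⁺_n + C⁺_n + (M+1)(M+1+c3)`. -/
def Sp (n c2 c3 M : ℝ) : ℝ := Ap n c2 c3 M + Cp n c2 c3 M + (M+1)*(M+1+c3)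

/-- `λ⁻(x; c123, c3; M) = (x+c123+M+1)(x−M−c3)`. -/
def lamM (x c123 c3 M : ℝ) : ℝ := (x+c123+M+1)*(x-M-c3)

/-- `A⁻_n(c1,c2,c3; M)`. -/
def Am (n c1 c2 c3 M : ℝ) : ℝ := -(n+c1+c2+c3+M+1)*(n+c1+c2+c3+M+2)*Ffun n c3 c2

/-- `C⁻_n(c1,c2,c3; M) = A⁻_{−n−c23−1}(c1,c2,c3; M)`. -/
def Cm (n c1 c2 c3 M : ℝ) : ℝ := Am (-n-c2-c3-1) c1 c2 c3 M

/-- `Σ⁻_n = A⁻_n + C⁻_n + (M+c12+1)(M+c123+1)`. -/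
def Sm (n c1 c2 c3 M : ℝ) : ℝ :=
  Am n c1 c2 c3 M + Cm n c1 c2 c3 M + (M+c1+c2+1)*(M+c1+c2+c3+1)

/-- `μ⁺_n(c123, c1; M) = (n+c123+M+2)(n−M−1−c1)`. -/
def muP (n c123 c1 M : ℝ) : ℝ := (n+c123+M+2)*(n-M-1-c1)

/-- `B⁺(x; c1,c2,c3; M)`. -/
def Bp (x c1 c2 c3 M : ℝ) : ℝ := -(x+c1+c2+c3+M+2)*(x+c1+c2+c3+M+3)*Ffun x c1 c2

/-- `D⁺(x; c1,c2,c3; M) = B⁺(−x−c12−1; c1,c2,c3; M)`. -/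
def Dp (x c1 c2 c3 M : ℝ) : ℝ := Bp (-x-c1-c2-1) c1 c2 c3 M

/-- `S⁺ = B⁺ + D⁺ + (c23+M+2)(c123+M+2)`. -/
def SpD (x c1 c2 c3 M : ℝ) : ℝ :=
  Bp x c1 c2 c3 M + Dp x c1 c2 c3 M + (c2+c3+M+2)*(c1+c2+c3+M+2)

/-- `μ⁻_n(c23; M) = (n−M)(n+c23+M+1)`. -/
def muM (n c23 M : ℝ) : ℝ := (n-M)*(n+c23+M+1)

/-- `B⁻(x; c1,c2; M)`. -/
def Bm (x c1 c2 M : ℝ) : ℝ := -(x-M)*(x-M+1)*Ffun x c1 c2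

/-- `D⁻(x; c1,c2; M) = B⁻(−x−c12−1; c1,c2; M)`. -/
def Dm (x c1 c2 M : ℝ) : ℝ := Bm (-x-c1-c2-1) c1 c2 M

/-- `S⁻ = B⁻ + D⁻ + M(c1+M)`. -/
def SmD (x c1 c2 M : ℝ) : ℝ := Bm x c1 c2 M + Dm x c1 c2 M + M*(c1+M)

/-- Nine-point recurrence coefficients `A^{e,e'}_{i,j}(c1,c2,c3,c4)` (with
`c0 = −2N−3−c1−c2−c3−c4`). -/
def nineA (e e' : ℤ) (i j : ℝ) (c1 c2 c3 c4 N : ℝ) : ℝ :=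
  let c0 : ℝ := -2*N-3-c1-c2-c3-c4
  if e = 1 ∧ e' = 1 then -(Ffun (-j-c0-c4-1) c4 c0) * Cm i c1 c2 c3 (N-j+1)
  else if e = 0 ∧ e' = 1 then (Ffun (-j-c0-c4-1) c4 c0) * Sm i c1 c2 c3 (N-j+1)
  else if e = -1 ∧ e' = 1 then -(Ffun (-j-c0-c4-1) c4 c0) * Am i c1 c2 c3 (N-j+1)
  else if e = 1 ∧ e' = -1 then -(Ffun j c4 c0) * Cp i c2 c3 (N-j-1)
  else if e = 0 ∧ e' = -1 then (Ffun j c4 c0) * Sp i c2 c3 (N-j-1)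
  else if e = -1 ∧ e' = -1 then -(Ffun j c4 c0) * Ap i c2 c3 (N-j-1)
  else if e = 1 ∧ e' = 0 then (Ffun j c4 c0 + Ffun (-j-c0-c4-1) c4 c0) * coefC i c1 c2 c3 (N-j)
  else if e = 0 ∧ e' = 0 then
    -(Ffun j c4 c0 + Ffun (-j-c0-c4-1) c4 c0) *
      (coefSig i c1 c2 c3 (N-j) + (N-j)^2 + (c1+c2+c3+2)*(N-j) + (1/2)*(c3+1)*(c1+c2+c3+1))
  else if e = -1 ∧ e' = 0 then (Ffun j c4 c0 + Ffun (-j-c0-c4-1) c4 c0) * coefA i c1 c2 c3 (N-j)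
  else 0

/-- `Γ^{0,0}_{i,j}(c1,c2,c3,c4)`. -/
def gam00 (i j : ℝ) (c1 c2 c3 c4 N : ℝ) : ℝ :=
  let c0 : ℝ := -2*N-3-c1-c2-c3-c4
  (-(coefSig i c1 c2 c3 (N-j)) + coefSig j c1 c0 c4 (N-i) - (1/4)*(c3^2-c4^2)
    + (i-N-(1/2)*(c4+1))*(i+(1/2)*(c2+c3-c0-c1))
    - (j-N-(1/2)*(c3+1))*(j+(1/2)*(c0+c4-c1-c2)))

/-- `Γ^{e,e'}_{i,j}` coefficients. -/
def gam (e e' : ℤ) (i j : ℝ) (c1 c2 c3 c4 N : ℝ) : ℝ :=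
  let c0 : ℝ := -2*N-3-c1-c2-c3-c4
  if e = 0 ∧ e' = 1 then coefC j c1 c0 c4 (N-i)
  else if e = 0 ∧ e' = -1 then coefA j c1 c0 c4 (N-i)
  else if e = 1 ∧ e' = 0 then coefC i c1 c2 c3 (N-j)
  else if e = -1 ∧ e' = 0 then coefA i c1 c2 c3 (N-j)
  else if e = 0 ∧ e' = 0 then gam00 i j c1 c2 c3 c4 N
  else 0

/-- Nine-point difference coefficients `D^{e,e'}(x,y; c1,c2,c3,c4)` (with
`c0 = −2N−3−c1−c2−c3−c4`). -/
def nineD (e e' : ℤ) (x y : ℝ) (c1 c2 c3 c4 N : ℝ) : ℝ :=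
  let c0 : ℝ := -2*N-3-c1-c2-c3-c4
  if e = 1 ∧ e' = 1 then -(Ffun x c1 c2) * Bm y c3 c0 (N-x)
  else if e = 1 ∧ e' = 0 then (Ffun x c1 c2) * SmD y c3 c0 (N-x)
  else if e = 1 ∧ e' = -1 then -(Ffun x c1 c2) * Dm y c3 c0 (N-x)
  else if e = -1 ∧ e' = 1 then -(Ffun (-x-c1-c2-1) c1 c2) * Bp y c3 c0 c4 (N-x)
  else if e = -1 ∧ e' = 0 then (Ffun (-x-c1-c2-1) c1 c2) * SpD y c3 c0 c4 (N-x)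
  else if e = -1 ∧ e' = -1 then -(Ffun (-x-c1-c2-1) c1 c2) * Dp y c3 c0 c4 (N-x)
  else if e = 0 ∧ e' = 1 then (Ffun x c1 c2 + Ffun (-x-c1-c2-1) c1 c2) * coefB y c3 c0 c4 (N-x)
  else if e = 0 ∧ e' = 0 then
    -(Ffun x c1 c2 + Ffun (-x-c1-c2-1) c1 c2) *
      (coefS y c3 c0 c4 (N-x) + (N-x)^2 + (c0+c3+c4+2)*(N-x) + (1/2)*(c3+1)*(c0+c3+c4+1))
  else if e = 0 ∧ e' = -1 then (Ffun x c1 c2 + Ffun (-x-c1-c2-1) c1 c2) * coefD y c3 c0 c4 (N-x)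
  else 0

/-- `Ψ^{a,b}(x,y)` coefficients: the first superscript refers to the shift in `y`,
the second to the shift in `x` (with `c0 = −2N−3−c1−c2−c3−c4`). -/
def psi (a b : ℤ) (x y : ℝ) (c1 c2 c3 c4 N : ℝ) : ℝ :=
  let c0 : ℝ := -2*N-3-c1-c2-c3-c4
  if a = 0 ∧ b = 1 then coefB x c4 c2 c1 (N-y)
  else if a = 0 ∧ b = -1 then coefD x c4 c2 c1 (N-y)
  else if a = 1 ∧ b = 0 then coefB y c3 c0 c1 (N-x)
  else if a = -1 ∧ b = 0 then coefD y c3 c0 c1 (N-x)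
  else if a = 0 ∧ b = 0 then gam00 x y c1 c2 c4 c3 N
  else 0

/-- Tratnik polynomial of Racah type `T_{i,j}(x,y; c1,c2,c3,c4; N)`, set to `0` outside
the triangular domains. -/
def trat (c1 c2 c3 c4 : ℝ) (Nn : ℕ) (i j x y : ℤ) : ℝ :=
  let c0 : ℝ := -2*(Nn:ℝ)-3-c1-c2-c3-c4
  if 0 ≤ i ∧ 0 ≤ j ∧ i + j ≤ (Nn:ℤ) ∧ 0 ≤ x ∧ 0 ≤ y ∧ x + y ≤ (Nn:ℤ) then
    racah i (x:ℝ) c1 c2 c3 ((Nn:ℤ)-j) * racah j (y:ℝ) c3 c0 c4 ((Nn:ℤ)-x)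
  else 0

/-- Griffiths polynomial of Racah type `G_{i,j}(x,y; c1,c2,c3,c4; N)`, set to `0` outside
the triangular domains. -/
def grif (c1 c2 c3 c4 : ℝ) (Nn : ℕ) (i j x y : ℤ) : ℝ :=
  let c0 : ℝ := -2*(Nn:ℝ)-3-c1-c2-c3-c4
  if 0 ≤ i ∧ 0 ≤ j ∧ i + j ≤ (Nn:ℤ) ∧ 0 ≤ x ∧ 0 ≤ y ∧ x + y ≤ (Nn:ℤ) then
    ∑ a ∈ Finset.range (((Nn:ℤ)-j).toNat + 1),
      (-1:ℝ)^a * racah i (a:ℝ) c1 c2 c3 ((Nn:ℤ)-j) * racah j (y:ℝ) c3 c0 c4 ((Nn:ℤ)-(a:ℤ)) *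
        racah (a:ℤ) (x:ℝ) c4 c2 c1 ((Nn:ℤ)-y)
  else 0

/-- Krawtchouk polynomial `K_n(x; p; M)`, set to `0` unless `0 ≤ n ≤ M`. -/
def kraw (n : ℤ) (x : ℝ) (p : ℝ) (M : ℤ) : ℝ :=
  if 0 ≤ n ∧ n ≤ M then
    (M.toNat.choose n.toNat : ℝ) * (p/(1-p))^n.toNat *
      ∑ k ∈ Finset.range (n.toNat + 1),
        poch (-(n:ℝ)) k * poch (-x) k / (poch (-(M:ℝ)) k * (Nat.factorial k : ℝ)) * (1/p)^k
  else 0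

theorem Generic.of_sub_eq {a r : ℝ} (h : Generic r) (m : ℤ) (ha : a - r = m) : Generic a := by
  intro k hk
  apply h (k - m)
  push_cast
  linarith

theorem Generic.of_add_eq {a r : ℝ} (h : Generic r) (m : ℤ) (ha : a + r = m) : Generic a := by
  intro k hk
  apply h (m - k)
  push_cast
  linarith

theorem Generic.ne_zero {a : ℝ} (h : Generic a) : a ≠ 0 := by
  simpa using h 0

theorem Generic.poch_ne_zero {a : ℝ} (h : Generic a) (k : ℕ) : poch a k ≠ 0 :=
  Finset.prod_ne_zero_iff.mpr fun n _ =>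
    (h.of_sub_eq (a := a + n) n (by push_cast; ring)).ne_zero

theorem poch_add (a : ℝ) (m n : ℕ) : poch a (m + n) = poch a m * poch (a + m) n := by
  simp only [poch, Finset.prod_range_add, Nat.cast_add, add_assoc]

theorem poch_eq_neg_one_pow_mul (a : ℝ) (k : ℕ) :
    poch a k = (-1) ^ k * poch (1 - a - k) k := by
  unfold poch
  rw [← Finset.prod_range_reflect, ← Finset.card_range k, ← Finset.prod_const,
    Finset.card_range, ← Finset.prod_mul_distrib]
  refine Finset.prod_congr rfl fun n hn => ?_
  have hn' : n + 1 ≤ k := Finset.mem_range.mp hn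
  rw [Nat.sub_sub, add_comm 1 n, Nat.cast_sub hn']
  push_cast
  ring

theorem poch_neg_natCast_eq_zero {m k : ℕ} (h : m < k) : poch (-(m : ℝ)) k = 0 :=
  Finset.prod_eq_zero (Finset.mem_range.mpr h) (by simp)

/-- The normalization `Om` does not vanish for generic parameters. -/
theorem Om_ne_zero {c1 c2 c3 : ℝ} (h1 : Generic c1) (h2 : Generic c2) (h3 : Generic c3)
    (h23 : Generic (c2 + c3)) (h123 : Generic (c1 + c2 + c3)) {n M : ℕ} (hn : n ≤ M) :
    Om n c1 c2 c3 M ≠ 0 := by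
  have hchoose : (M.choose n : ℝ) ≠ 0 := by exact_mod_cast (Nat.choose_pos hn).ne'
  have hlin := (h23.of_sub_eq (a := 2 * (n : ℝ) + c2 + c3 + 1) (2 * n + 1)
    (by push_cast; ring)).ne_zero
  have p1 (k : ℕ) := (h1.of_sub_eq (a := c1 + 1) 1 (by push_cast; ring)).poch_ne_zero k
  have p2 (k : ℕ) := (h2.of_sub_eq (a := c2 + 1) 1 (by push_cast; ring)).poch_ne_zero k
  have p3 (k : ℕ) := (h3.of_sub_eq (a := c3 + 1) 1 (by push_cast; ring)).poch_ne_zero k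
  have p123 (k : ℕ) := (h123.of_sub_eq (a := (M : ℝ) + 2 + c1 + c2 + c3) (M + 2)
    (by push_cast; ring)).poch_ne_zero k
  have p23 (k : ℕ) := (h23.of_sub_eq (a := c2 + c3 + (n : ℝ) + 1) (n + 1)
    (by push_cast; ring)).poch_ne_zero k
  simp only [Om, Int.toNat_natCast, Int.cast_natCast]
  exact div_ne_zero
    (mul_ne_zero (mul_ne_zero (mul_ne_zero (mul_ne_zero hchoose hlin) (p2 _)) (p123 _)) (p1 _))
    (mul_ne_zero (p3 _) (p23 _))

/-- The terminating hypergeometric sum defining the Racah polynomials, up to degree `n`. -/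
def racahSum (n x : ℕ) (c1 c2 c3 : ℝ) (M : ℕ) : ℝ :=
  ∑ k ∈ Finset.range (n + 1),
    (poch (-(n : ℝ)) k * poch (n + c2 + c3 + 1) k * poch (-(x : ℝ)) k * poch (x + c1 + c2 + 1) k) /
      (poch (c2 + 1) k * poch (M + 2 + c1 + c2 + c3) k * poch (-(M : ℝ)) k * (Nat.factorial k : ℝ))

theorem racah_eq_Om_mul_racahSum {n M : ℕ} (hn : n ≤ M) (x : ℕ) (c1 c2 c3 : ℝ) :
    racah n x c1 c2 c3 M = Om n c1 c2 c3 M * racahSum n x c1 c2 c3 M := by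
  simp [racah, racahSum, hn]

theorem racahSum_eq_of_le {n K : ℕ} (hK : n ≤ K) (x : ℕ) (c1 c2 c3 : ℝ) (M : ℕ) :
    racahSum n x c1 c2 c3 M = ∑ k ∈ Finset.range (K + 1),
      (poch (-(n : ℝ)) k * poch (n + c2 + c3 + 1) k * poch (-(x : ℝ)) k *
        poch (x + c1 + c2 + 1) k) /
      (poch (c2 + 1) k * poch (M + 2 + c1 + c2 + c3) k * poch (-(M : ℝ)) k *
        (Nat.factorial k : ℝ)) := by
  refine Finset.sum_subset (Finset.range_mono (by omega)) fun k _ hk => ?_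
  rw [poch_neg_natCast_eq_zero (by simpa using hk : n < k)]
  simp

/-- Self-duality of the hypergeometric sum: exchanging degree and variable. -/
theorem racahSum_comm (n x : ℕ) (c1 c2 c3 : ℝ) (M : ℕ) :
    racahSum n x c1 c2 c3 M = racahSum x n c3 c2 c1 M := by
  rw [racahSum_eq_of_le (le_max_left n x), racahSum_eq_of_le (le_max_right n x)]
  refine Finset.sum_congr rfl fun k _ => ?_
  rw [show (M : ℝ) + 2 + c1 + c2 + c3 = M + 2 + c3 + c2 + c1 by ring,
    show (n : ℝ) + c2 + c3 + 1 = n + c3 + c2 + 1 by ring,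
    show (x : ℝ) + c1 + c2 + 1 = x + c2 + c1 + 1 by ring]
  ring

theorem Om_div_Lam {a b c : ℝ} (hb : Generic b) (hc : Generic c) (hbc : Generic (b + c))
    (j x r : ℕ) :
    Om j a b c ((j + r : ℕ) : ℤ) / Lam j c b ((j + r + x : ℕ) : ℤ) =
      (-1) ^ j * ((j + r).choose j / (j + r + x).choose j) *
        poch (((j + r : ℕ) : ℝ) + 2 + a + b + c) j * poch (a + 1) r *
        poch (b + c + j + 1 + ((j + r + 1 : ℕ) : ℝ)) x := by
  have hchoose : ((j + r + x).choose j : ℝ) ≠ 0 := by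
    exact_mod_cast (Nat.choose_pos (by omega)).ne'
  have hlin := (hbc.of_sub_eq (a := 2 * (j : ℝ) + b + c + 1) (2 * j + 1)
    (by push_cast; ring)).ne_zero
  have pb := (hb.of_sub_eq (a := b + 1) 1 (by push_cast; ring)).poch_ne_zero j
  have pc := (hc.of_sub_eq (a := c + 1) 1 (by push_cast; ring)).poch_ne_zero j
  have pbc (k : ℕ) := (hbc.of_sub_eq (a := b + c + (j : ℝ) + 1) (j + 1)
    (by push_cast; ring)).poch_ne_zero k
  have hsub : (((j + r : ℕ) : ℤ) - (j : ℤ)).toNat = r := by omega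
  have hsign : ((-1 : ℝ) ^ j) * (-1) ^ j = 1 := by rw [← mul_pow]; simp
  have hsign0 : ((-1 : ℝ) ^ j) ≠ 0 := by simp
  simp only [Om, Lam, Int.toNat_natCast, Int.cast_natCast, hsub]
  rw [show (j : ℝ) + c + b + 1 = b + c + j + 1 by ring,
    show 2 * (j : ℝ) + c + b + 1 = 2 * j + b + c + 1 by ring,
    show j + r + x + 1 = (j + r + 1) + x by ring, poch_add (b + c + j + 1) (j + r + 1) x]
  have h1 := pbc (j + r + 1)
  generalize poch (b + c + (j : ℝ) + 1) (j + r + 1) = P at *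
  generalize (-1 : ℝ) ^ j = s at *
  field_simp
  linear_combination (-(((j + r).choose j : ℝ) * poch (((j + r : ℕ) : ℝ) + 2 + a + b + c) j *
    poch (a + 1) r * poch (b + c + j + 1 + ((j + r + 1 : ℕ) : ℝ)) x)) * hsign

theorem choose_div_choose_comm (j x r : ℕ) :
    ((j + r).choose j : ℝ) / (j + r + x).choose j =
      ((x + r).choose x : ℝ) / (x + r + j).choose x := by
  have e1 := Nat.choose_mul (n := j + r + x) (k := j + x) (s := j) (by omega)
  have e2 := Nat.choose_mul (n := j + r + x) (k := j + x) (s := x) (by omega)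
  rw [show j + r + x - j = x + r by omega, show j + x - j = x by omega] at e1
  rw [show j + r + x - x = j + r by omega, show j + x - x = j by omega] at e2
  have e3 := Nat.choose_symm_add (a := j) (b := x)
  rw [show x + r + j = j + r + x by omega]
  have h1 : ((j + r + x).choose j : ℝ) ≠ 0 := by
    exact_mod_cast (Nat.choose_pos (by omega)).ne'
  have h2 : ((j + r + x).choose x : ℝ) ≠ 0 := by
    exact_mod_cast (Nat.choose_pos (by omega)).ne'
  rw [div_eq_div_iff h1 h2]
  have : (j + r).choose j * (j + r + x).choose x = (x + r).choose x * (j + r + x).choose j := by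
    rw [mul_comm, ← e2, ← e3, e1, mul_comm]
  exact_mod_cast this

/-- The ratios of normalization and weight on both sides of the duality agree. -/
theorem Om_div_Lam_comm {c0 c1 c2 c3 c4 : ℝ} (h0 : Generic c0) (h4 : Generic c4)
    (h04 : Generic (c0 + c4)) (h1 : Generic c1) (h2 : Generic c2) (h21 : Generic (c2 + c1))
    (j x r : ℕ) (hsum : c0 + c1 + c2 + c3 + c4 = -2 * ((j + r + x : ℕ) : ℝ) - 3) :
    Om j c3 c0 c4 ((j + r : ℕ) : ℤ) / Lam j c4 c0 ((j + r + x : ℕ) : ℤ) =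
      Om x c3 c2 c1 ((x + r : ℕ) : ℤ) / Lam x c1 c2 ((j + r + x : ℕ) : ℤ) := by
  have hN : j + r + x = x + r + j := by omega
  rw [Om_div_Lam h0 h4 h04]
  rw [show ((j + r + x : ℕ) : ℤ) = ((x + r + j : ℕ) : ℤ) by rw [hN], Om_div_Lam h2 h1 h21,
    choose_div_choose_comm j x r,
    poch_eq_neg_one_pow_mul (((j + r : ℕ) : ℝ) + 2 + c3 + c0 + c4) j,
    poch_eq_neg_one_pow_mul (((x + r : ℕ) : ℝ) + 2 + c3 + c2 + c1) x]
  push_cast at hsum ⊢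
  rw [show 1 - ((j : ℝ) + r + 2 + c3 + c0 + c4) - j = c2 + c1 + x + 1 + (x + r + 1) by linarith,
    show 1 - ((x : ℝ) + r + 2 + c3 + c2 + c1) - x = c0 + c4 + j + 1 + (j + r + 1) by linarith]
  have hj : ((-1 : ℝ) ^ j) * (-1) ^ j = 1 := by rw [← mul_pow]; simp
  have hx : ((-1 : ℝ) ^ x) * (-1) ^ x = 1 := by rw [← mul_pow]; simp
  generalize ((x + r).choose x : ℝ) / (x + r + j).choose x = q
  generalize poch (c2 + c1 + (x : ℝ) + 1 + (x + r + 1)) j = P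
  generalize poch (c0 + c4 + (j : ℝ) + 1 + (j + r + 1)) x = Q
  generalize poch (c3 + 1) r = R
  linear_combination (q * P * Q * R) * (hj - hx)

/-- duality relation for the Tratnik polynomials of Racah type. -/
theorem tratnik_duality
    (Nn : ℕ) (c1 c2 c3 c4 : ℝ) (hgen : Generic4 c1 c2 c3 c4)
    (c0 : ℝ) (hc0 : c0 = -2*(Nn:ℝ)-3-c1-c2-c3-c4)
    (i j x y : ℤ) (hi : 0 ≤ i) (hj : 0 ≤ j) (hij : i + j ≤ (Nn:ℤ))
    (hx : 0 ≤ x) (hy : 0 ≤ y) (hxy : x + y ≤ (Nn:ℤ)) :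
    trat c1 c2 c3 c4 Nn i j x y / (Om i c1 c2 c3 ((Nn:ℤ)-j) * Lam j c4 c0 (Nn:ℤ)) =
      trat c4 c0 c3 c1 Nn y x j i / (Om y c4 c0 c3 ((Nn:ℤ)-x) * Lam x c1 c2 (Nn:ℤ)) := by
  lift i to ℕ using hi
  lift j to ℕ using hj
  lift x to ℕ using hx
  lift y to ℕ using hy
  obtain ⟨g1, g2, g3, g4, g12, -, -, g23, -, -, g123, g124, -, -, g1234⟩ := hgen
  have hc2 : -2 * (Nn : ℝ) - 3 - c4 - c0 - c3 - c1 = c2 := by rw [hc0]; ring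
  simp only [trat, hc2, ← hc0]
  rw [if_pos (by omega), if_pos (by omega)]
  by_cases hjx : j + x ≤ Nn
  · obtain ⟨r, rfl⟩ : ∃ r, Nn = j + r + x := ⟨Nn - j - x, by omega⟩
    have hNj : ((j + r + x : ℕ) : ℤ) - (j : ℤ) = ((x + r : ℕ) : ℤ) := by push_cast; ring
    have hNx : ((j + r + x : ℕ) : ℤ) - (x : ℤ) = ((j + r : ℕ) : ℤ) := by push_cast; ring
    have h0 : Generic c0 := g1234.of_add_eq (-2 * (j + r + x : ℕ) - 3) (by
      rw [hc0]; push_cast; ring)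
    have h03 : Generic (c0 + c3) := g124.of_add_eq (-2 * (j + r + x : ℕ) - 3) (by
      rw [hc0]; push_cast; ring)
    have h04 : Generic (c0 + c4) := g123.of_add_eq (-2 * (j + r + x : ℕ) - 3) (by
      rw [hc0]; push_cast; ring)
    have h403 : Generic (c4 + c0 + c3) := g12.of_add_eq (-2 * (j + r + x : ℕ) - 3) (by
      rw [hc0]; push_cast; ring)
    have h21 : Generic (c2 + c1) := by rwa [add_comm]
    have hratio := Om_div_Lam_comm (c3 := c3) h0 g4 h04 g1 g2 h21 j x r (by rw [hc0]; ring)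
    have hOi : Om i c1 c2 c3 ((x + r : ℕ) : ℤ) ≠ 0 := Om_ne_zero g1 g2 g3 g23 g123 (by omega)
    have hOy : Om y c4 c0 c3 ((j + r : ℕ) : ℤ) ≠ 0 := Om_ne_zero g4 h0 g3 h03 h403 (by omega)
    simp only [hNj, hNx, Int.cast_natCast]
    rw [racah_eq_Om_mul_racahSum (by omega), racah_eq_Om_mul_racahSum (by omega),
      racah_eq_Om_mul_racahSum (by omega), racah_eq_Om_mul_racahSum (by omega),
      racahSum_comm x i, racahSum_comm y j]
    generalize racahSum i x c1 c2 c3 (x + r) = S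
    generalize racahSum j y c3 c0 c4 (j + r) = S'
    rw [show ∀ a b d e : ℝ, a * S * (b * S') / (d * e) = (a / d) * (b / e) * (S * S') by
        intros; ring, div_self hOi, hratio]
    rw [show ∀ a b d e : ℝ, a * S' * (b * S) / (d * e) = (a / d) * (b / e) * (S * S') by
        intros; ring, div_self hOy]
  · rw [racah.eq_def j, if_neg (by omega), racah.eq_def x, if_neg (by omega)]
    simp
end
end

section
/- Let c1, c2, c3, c4 be generic real numbers, N ≥ 0 an integer, and c0 = −2N−3−c1−c2−c3−c4. For all integers i, j, x, y ≥ 0 with i+j ≤ N and x+y ≤ N, the Tratnik polynomials of Racah type satisfy the difference equation μ_j(c_{04}) · T_{i,j}(x,y) = B(y; c3,c0,c4; N−x) · T_{i,j}(x, y+1) − S(y; c3,c0,c4; N−x) · T_{i,j}(x,y) + D(y; c3,c0,c4; N−x) · T_{i,j}(x, y−1). -/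
open Finset

noncomputable section

theorem poch_zero (a : ℝ) : poch a 0 = 1 := by simp [poch]

theorem poch_succ (a : ℝ) (k : ℕ) : poch a (k+1) = poch a k * (a + k) := by
  simp [poch, Finset.prod_range_succ]

theorem poch_succ_left (a : ℝ) (k : ℕ) : poch a (k+1) = a * poch (a+1) k := by
  simp only [poch, Finset.prod_range_succ']
  rw [mul_comm]
  congr 1
  · simp
  · refine Finset.prod_congr rfl fun i _ => ?_
    push_cast; ring

/-- A linear form in a generic number with integer constant term does not vanish. -/
theorem Generic.ne_zero_s9 {r s : ℝ} (h : Generic r) (m : ℤ) (hs : s = m - r) : s ≠ 0 := by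
  intro h0
  exact h m (by linarith)

/-- The basis `(-x)_k (x+c1+c2+1)_k` in which Racah polynomials are expanded. -/
def racahBasis (x c1 c2 : ℝ) (k : ℕ) : ℝ := poch (-x) k * poch (x+c1+c2+1) k

/-- The coefficients of a Racah polynomial in the basis `racahBasis`. -/
def racahCoeff (n c1 c2 c3 M : ℝ) (k : ℕ) : ℝ :=
  poch (-n) k * poch (n+c2+c3+1) k /
    (poch (c2+1) k * poch (M+2+c1+c2+c3) k * poch (-M) k * (Nat.factorial k : ℝ))

/-- The Racah difference operator `B (E - 1) + D (E⁻¹ - 1)`. -/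
def racahOp (f : ℝ → ℝ) (x c1 c2 c3 M : ℝ) : ℝ :=
  coefB x c1 c2 c3 M * (f (x+1) - f x) + coefD x c1 c2 c3 M * (f (x-1) - f x)

theorem racahOp_basis_zero (x c1 c2 c3 M : ℝ) :
    racahOp (fun z => racahBasis z c1 c2 0) x c1 c2 c3 M = 0 := by
  simp [racahOp, racahBasis, poch_zero]

/-- The Racah difference operator is bidiagonal in the basis `racahBasis`. -/
theorem racahOp_basis_succ {x c1 c2 : ℝ} (c3 M : ℝ) (k : ℕ)
    (h0 : 2*x+c1+c2 ≠ 0) (h1 : 2*x+c1+c2+1 ≠ 0) (h2 : 2*x+c1+c2+2 ≠ 0) :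
    racahOp (fun z => racahBasis z c1 c2 (k+1)) x c1 c2 c3 M =
      mu ((k:ℝ)+1) (c2+c3) * racahBasis x c1 c2 (k+1)
        - (c2+1+k)*(M+2+c1+c2+c3+k)*(-M+k)*(k+1) * racahBasis x c1 c2 k := by
  set P := poch (-x) k with hP
  set Q := poch (x+c1+c2+1) k with hQ
  have e1 : poch (-x) (k+1) = P * (-x+k) := poch_succ _ _
  have e2 : poch (x+c1+c2+1) (k+1) = Q * (x+c1+c2+1+k) := poch_succ _ _
  have e3 : poch (-(x+1)) (k+1) = (-x-1) * P := by
    rw [poch_succ_left, hP, show -(x+1)+1 = -x by ring]; ring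
  have e4 : poch (x-1+c1+c2+1) (k+1) = (x+c1+c2) * Q := by
    rw [poch_succ_left, hQ, show x-1+c1+c2+1+1 = x+c1+c2+1 by ring]; ring
  have e5 : x * poch (-(x-1)) (k+1) = -(P * (-x+k) * (-x+k+1)) := by
    have h := poch_succ_left (-x) (k+1)
    rw [poch_succ, e1, show -x+1 = -(x-1) by ring] at h
    push_cast at h
    linarith
  have e6 : (x+c1+c2+1) * poch (x+1+c1+c2+1) (k+1) = Q * (x+c1+c2+1+k) * (x+c1+c2+2+k) := by
    have h := poch_succ_left (x+c1+c2+1) (k+1)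
    rw [poch_succ, e2, show x+c1+c2+1+1 = x+1+c1+c2+1 by ring] at h
    push_cast at h
    linarith
  have hB : coefB x c1 c2 c3 M * (racahBasis (x+1) c1 c2 (k+1) - racahBasis x c1 c2 (k+1)) =
      (x-M)*(x+c2+1)*(x+c1+c2+c3+M+2)/((2*x+c1+c2+1)*(2*x+c1+c2+2)) *
        ((-x-1)*P*(Q*(x+c1+c2+1+k)*(x+c1+c2+2+k))
          - (x+c1+c2+1)*(P*(-x+k)*(Q*(x+c1+c2+1+k)))) := by
    rw [← e6]
    simp only [coefB, racahBasis, e1, e2, e3]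
    ring
  have hD : coefD x c1 c2 c3 M * (racahBasis (x-1) c1 c2 (k+1) - racahBasis x c1 c2 (k+1)) =
      (x+c1)*(x-c3-M-1)*(x+c1+c2+M+1)/((2*x+c1+c2)*(2*x+c1+c2+1)) *
        (-(P*(-x+k)*(-x+k+1))*((x+c1+c2)*Q) - x*(P*(-x+k)*(Q*(x+c1+c2+1+k)))) := by
    rw [← e5]
    simp only [coefD, racahBasis, e1, e2, e4]
    ring
  simp only [racahOp]
  rw [hB, hD]
  clear_value P Q
  simp only [racahBasis, mu, e1, e2, ← hP, ← hQ]
  rw [div_mul_eq_mul_div, div_mul_eq_mul_div,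
    div_add_div _ _ (mul_ne_zero h1 h2) (mul_ne_zero h0 h1),
    div_eq_iff (mul_ne_zero (mul_ne_zero h1 h2) (mul_ne_zero h0 h1))]
  ring

theorem racahCoeff_succ {n c1 c2 c3 M : ℝ} {k : ℕ} (h2 : c2+1+k ≠ 0)
    (h3 : M+2+c1+c2+c3+k ≠ 0) (hM : -M+k ≠ 0) :
    racahCoeff n c1 c2 c3 M (k+1) * ((c2+1+k)*(M+2+c1+c2+c3+k)*(-M+k)*(k+1)) =
      racahCoeff n c1 c2 c3 M k * ((-n+k)*(n+c2+c3+1+k)) := by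
  have hk : (k:ℝ)+1 ≠ 0 := by positivity
  simp only [racahCoeff, poch_succ, Nat.factorial_succ]
  push_cast
  rw [div_mul_eq_mul_div, div_mul_eq_mul_div,
    show poch (c2+1) k * (c2+1+k) * (poch (M+2+c1+c2+c3) k * (M+2+c1+c2+c3+k)) *
        (poch (-M) k * (-M+k)) * (((k:ℝ)+1) * (Nat.factorial k : ℝ)) =
      (poch (c2+1) k * poch (M+2+c1+c2+c3) k * poch (-M) k * (Nat.factorial k : ℝ)) *
        ((c2+1+k)*(M+2+c1+c2+c3+k)*(-M+k)*(k+1)) by ring,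
    mul_div_mul_right _ _ (by simp [h2, h3, hM, hk])]
  ring

theorem racahOp_sum (s : Finset ℕ) (a : ℕ → ℝ) (f : ℕ → ℝ → ℝ) (x c1 c2 c3 M : ℝ) :
    racahOp (fun z => ∑ k ∈ s, a k * f k z) x c1 c2 c3 M =
      ∑ k ∈ s, a k * racahOp (f k) x c1 c2 c3 M := by
  simp only [racahOp, ← Finset.sum_sub_distrib, Finset.mul_sum, ← Finset.sum_add_distrib]
  exact Finset.sum_congr rfl fun k _ => by ring

/-- Telescoping of the partial sums of the Racah difference equation. -/
theorem racah_partial_sum {n : ℕ} {x c1 c2 c3 M : ℝ}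
    (h0 : 2*x+c1+c2 ≠ 0) (h1 : 2*x+c1+c2+1 ≠ 0) (h2 : 2*x+c1+c2+2 ≠ 0)
    (g2 : ∀ k < n, c2+1+(k:ℝ) ≠ 0) (g3 : ∀ k < n, M+2+c1+c2+c3+(k:ℝ) ≠ 0)
    (gM : ∀ k < n, -M+(k:ℝ) ≠ 0) (m : ℕ) (hm : m ≤ n) :
    ∑ k ∈ Finset.range (m+1), racahCoeff n c1 c2 c3 M k *
        (mu n (c2+c3) * racahBasis x c1 c2 k
          - racahOp (fun z => racahBasis z c1 c2 k) x c1 c2 c3 M) =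
      racahCoeff n c1 c2 c3 M m * (((n:ℝ)-m)*(n+c2+c3+1+m)) * racahBasis x c1 c2 m := by
  induction m with
  | zero =>
    simp only [zero_add, Finset.sum_range_one, racahOp_basis_zero, mu, Nat.cast_zero]
    ring
  | succ m ih =>
    rw [Finset.sum_range_succ, ih (by omega), racahOp_basis_succ c3 M m h0 h1 h2]
    have h := racahCoeff_succ (n := n) (g2 m (by omega)) (g3 m (by omega)) (gM m (by omega))
    simp only [mu]
    push_cast
    linear_combination racahBasis x c1 c2 m * h

theorem racah_eq {n M : ℤ} (hn : 0 ≤ n) (hnM : n ≤ M) (x c1 c2 c3 : ℝ) :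
    racah n x c1 c2 c3 M = Om n c1 c2 c3 M *
      ∑ k ∈ Finset.range (n.toNat + 1), racahCoeff n c1 c2 c3 M k * racahBasis x c1 c2 k := by
  rw [racah, if_pos ⟨hn, hnM⟩]
  congr 1
  refine Finset.sum_congr rfl fun k _ => ?_
  simp only [racahCoeff, racahBasis]
  ring

/-- The difference equation of the renormalized Racah polynomials. -/
theorem racah_difference {n M : ℤ} {x c1 c2 c3 : ℝ}
    (h0 : 2*x+c1+c2 ≠ 0) (h1 : 2*x+c1+c2+1 ≠ 0) (h2 : 2*x+c1+c2+2 ≠ 0)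
    (g2 : ∀ k : ℕ, c2+1+(k:ℝ) ≠ 0) (g3 : ∀ k : ℕ, (M:ℝ)+2+c1+c2+c3+(k:ℝ) ≠ 0) :
    mu n (c2+c3) * racah n x c1 c2 c3 M =
      coefB x c1 c2 c3 M * racah n (x+1) c1 c2 c3 M
        - coefS x c1 c2 c3 M * racah n x c1 c2 c3 M
        + coefD x c1 c2 c3 M * racah n (x-1) c1 c2 c3 M := by
  by_cases hn : 0 ≤ n ∧ n ≤ M
  swap
  · simp [racah, hn]
  obtain ⟨hn, hnM⟩ := hn
  lift n to ℕ using hn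
  simp only [racah_eq (Int.natCast_nonneg n) hnM, Int.toNat_natCast, Int.cast_natCast]
  have gM : ∀ k < n, -(M:ℝ)+(k:ℝ) ≠ 0 := by
    intro k hk h
    have : (k:ℤ) < M := by omega
    have : (k:ℝ) < (M:ℝ) := by exact_mod_cast this
    linarith
  have h := racah_partial_sum h0 h1 h2 (fun k _ => g2 k) (fun k _ => g3 k) gM n le_rfl
  have hL := racahOp_sum (Finset.range (n+1)) (racahCoeff n c1 c2 c3 M)
    (fun k z => racahBasis z c1 c2 k) x c1 c2 c3 M
  have hmu : mu (n:ℝ) (c2+c3) *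
      ∑ k ∈ Finset.range (n+1), racahCoeff n c1 c2 c3 M k * racahBasis x c1 c2 k =
      racahOp (fun z => ∑ k ∈ Finset.range (n+1),
        racahCoeff n c1 c2 c3 M k * racahBasis z c1 c2 k) x c1 c2 c3 M := by
    rw [hL, ← sub_eq_zero, Finset.mul_sum, ← Finset.sum_sub_distrib]
    rw [sub_self, zero_mul, mul_zero, zero_mul] at h
    rw [← h]
    exact Finset.sum_congr rfl fun k _ => by ring
  simp only [racahOp] at hmu
  simp only [coefS]
  linear_combination Om n c1 c2 c3 M * hmu

/-- three-term difference equation in `y` for the Tratnik polynomials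
of Racah type. -/
theorem tratnik_difference_y
    (Nn : ℕ) (c1 c2 c3 c4 : ℝ) (hgen : Generic4 c1 c2 c3 c4)
    (c0 : ℝ) (hc0 : c0 = -2*(Nn:ℝ)-3-c1-c2-c3-c4)
    (i j x y : ℤ) (hi : 0 ≤ i) (hj : 0 ≤ j) (hij : i + j ≤ (Nn:ℤ))
    (hx : 0 ≤ x) (hy : 0 ≤ y) (hxy : x + y ≤ (Nn:ℤ)) :
    mu (j:ℝ) (c0+c4) * trat c1 c2 c3 c4 Nn i j x y =
      coefB (y:ℝ) c3 c0 c4 ((Nn:ℝ)-(x:ℝ)) * trat c1 c2 c3 c4 Nn i j x (y+1)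
        - coefS (y:ℝ) c3 c0 c4 ((Nn:ℝ)-(x:ℝ)) * trat c1 c2 c3 c4 Nn i j x y
        + coefD (y:ℝ) c3 c0 c4 ((Nn:ℝ)-(x:ℝ)) * trat c1 c2 c3 c4 Nn i j x (y-1) := by
  obtain ⟨-, -, -, -, h12, -, -, -, -, -, -, h124, -, -, h1234⟩ := hgen
  have key := racah_difference (n := j) (M := (Nn:ℤ)-x) (x := (y:ℝ)) (c1 := c3) (c2 := c0)
    (c3 := c4)
    (h124.ne_zero_s9 (2*y-2*Nn-3) (by push_cast; linarith))
    (h124.ne_zero_s9 (2*y-2*Nn-2) (by push_cast; linarith))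
    (h124.ne_zero_s9 (2*y-2*Nn-1) (by push_cast; linarith))
    (fun k => h1234.ne_zero_s9 (k-2*Nn-2) (by push_cast; linarith))
    (fun k => h12.ne_zero_s9 (k-Nn-x-1) (by push_cast; linarith))
  push_cast at key
  have hcur : trat c1 c2 c3 c4 Nn i j x y =
      racah i x c1 c2 c3 (Nn-j) * racah j y c3 c0 c4 (Nn-x) := by
    simp only [trat, ← hc0]
    rw [if_pos ⟨hi, hj, hij, hx, hy, hxy⟩]
  have hup : coefB y c3 c0 c4 (Nn-x) * trat c1 c2 c3 c4 Nn i j x (y+1) =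
      coefB y c3 c0 c4 (Nn-x) *
        (racah i x c1 c2 c3 (Nn-j) * racah j ((y:ℝ)+1) c3 c0 c4 (Nn-x)) := by
    rcases hxy.lt_or_eq with h | h
    · simp only [trat, ← hc0]
      rw [if_pos ⟨hi, hj, hij, hx, by omega, by omega⟩]
      push_cast
      rfl
    · have : (y:ℝ) - ((Nn:ℝ)-x) = 0 := by
        have : (x:ℝ) + y = Nn := by exact_mod_cast h
        linarith
      simp [coefB, this]
  have hdown : coefD y c3 c0 c4 (Nn-x) * trat c1 c2 c3 c4 Nn i j x (y-1) =
      coefD y c3 c0 c4 (Nn-x) *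
        (racah i x c1 c2 c3 (Nn-j) * racah j ((y:ℝ)-1) c3 c0 c4 (Nn-x)) := by
    rcases hy.lt_or_eq with h | h
    · simp only [trat, ← hc0]
      rw [if_pos ⟨hi, hj, hij, hx, by omega, by omega⟩]
      push_cast
      rfl
    · simp [coefD, ← h]
  rw [hup, hdown, hcur]
  linear_combination racah i x c1 c2 c3 (Nn-j) * key
end
end
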